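/- Let K > 0 and v > 0 be real constants, and let d : ℝ → ℝ be a differentiable function satisfying d'(t) = −K·d(t) / √(1 + (K·d(t)/v)²) for all t ∈ ℝ. Then d(t) converges to 0 as t → ∞, i.e., Tendsto d atTop (𝓝 0). -/

import Mathlib

open Filter

/-- A differential inequality `f' ≤ -c f` on `[0, ∞)` forces exponential decay. -/
theorem le_mul_exp_neg_of_hasDerivAt_le {f f' : ℝ → ℝ} {c : ℝ}
    (hf : ∀ t, HasDerivAt f (f' t) t) (hle : ∀ t, 0 ≤ t → f' t ≤ -c * f t)
    {t : ℝ} (ht : 0 ≤ t) : f t ≤ f 0 * Real.exp (-(c * t)) := by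
  have hg : ∀ s, HasDerivAt (fun s => f s * Real.exp (c * s))
      ((f' s + c * f s) * Real.exp (c * s)) s := fun s =>
    ((hf s).mul ((hasDerivAt_id s).const_mul c).exp).congr_deriv (by simp only [id]; ring)
  have hanti : AntitoneOn (fun s => f s * Real.exp (c * s)) (Set.Ici 0) := by
    refine antitoneOn_of_hasDerivWithinAt_nonpos (convex_Ici 0)
      (fun s _ => (hg s).continuousAt.continuousWithinAt)
      (fun s _ => (hg s).hasDerivWithinAt) fun s hs => ?_
    have hs' : 0 ≤ s := interior_subset hs
    exact mul_nonpos_of_nonpos_of_nonneg (by linarith [hle s hs']) (Real.exp_pos _).le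
  have h : f t * Real.exp (c * t) ≤ f 0 := by
    simpa using hanti Set.self_mem_Ici ht ht
  rw [Real.exp_neg, ← div_eq_mul_inv]
  exact (le_div_iff₀ (Real.exp_pos _)).2 h

theorem stanley_cross_track_error_tendsto_zero
    (K v : ℝ) (hK : 0 < K) (hv : 0 < v)
    (d : ℝ → ℝ) (hd : Differentiable ℝ d)
    (hode : ∀ t : ℝ, deriv d t = -K * d t / Real.sqrt (1 + (K * d t / v) ^ 2)) :
    Tendsto d atTop (nhds 0) := by
  let S : ℝ → ℝ := fun t => Real.sqrt (1 + (K * d t / v) ^ 2)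
  have hS : ∀ t, 0 < S t := fun t => Real.sqrt_pos.2 (by positivity)
  have hsq : ∀ t, HasDerivAt (fun t => d t ^ 2) (-(2 * K / S t * d t ^ 2)) t := fun t =>
    ((hd t).hasDerivAt.pow 2).congr_deriv (by
      rw [hode t]
      change _ * (-K * d t / S t) = _
      push_cast
      ring)
  have hanti : Antitone fun t => d t ^ 2 := by
    refine antitone_of_hasDerivAt_nonpos hsq fun t => ?_
    have := hS t
    simp only [Pi.zero_apply, Left.neg_nonpos_iff]
    positivity
  have hSle : ∀ t, 0 ≤ t → S t ≤ S 0 := fun t ht => by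
    refine Real.sqrt_le_sqrt ?_
    have h : d t ^ 2 ≤ d 0 ^ 2 := hanti ht
    rw [div_pow, div_pow, mul_pow, mul_pow]
    gcongr
  have hdecay : ∀ t, 0 ≤ t → d t ^ 2 ≤ d 0 ^ 2 * Real.exp (-(2 * K / S 0 * t)) := fun t ht => by
    refine le_mul_exp_neg_of_hasDerivAt_le hsq (fun s hs => ?_) ht
    have h : 2 * K / S 0 ≤ 2 * K / S s :=
      div_le_div_of_nonneg_left (by positivity) (hS s) (hSle s hs)
    nlinarith [mul_le_mul_of_nonneg_right h (sq_nonneg (d s))]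
  have hexp : Tendsto (fun t => d 0 ^ 2 * Real.exp (-(2 * K / S 0 * t))) atTop (nhds 0) := by
    have hc : 0 < 2 * K / S 0 := div_pos (by positivity) (hS 0)
    simpa using (Real.tendsto_exp_neg_atTop_nhds_zero.comp
      (tendsto_id.const_mul_atTop hc)).const_mul (d 0 ^ 2)
  have hlim : Tendsto (fun t => d t ^ 2) atTop (nhds 0) :=
    squeeze_zero' (Eventually.of_forall fun t => sq_nonneg (d t))
      ((eventually_ge_atTop 0).mono hdecay) hexp
  rw [tendsto_zero_iff_abs_tendsto_zero]
  simpa [Function.comp_def, Real.sqrt_sq_eq_abs] using hlim.sqrt
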